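/- arXiv:2203.15122 — 2 statements merged into one kernel-verified Lean document; each statement's English description precedes it below -/
import Mathlib

section
/- Let X, Y be smooth vector fields on a manifold N with X ∧ Y ≠ 0 everywhere, and suppose [X,Y] = aX + bY for smooth functions a, b on N. Then locally there exist nowhere-vanishing smooth functions f, g on N such that [fX, gY] = 0. -/
open Set Filter Topology
abbrev II := Icc (0:ℝ) 1

noncomputable def ptw (E G : Type*) [NormedAddCommGroup E] [NormedSpace ℝ E] [NormedAddCommGroup G] [NormedSpace ℝ G] :
    C(II, E →L[ℝ] G) →L[ℝ] C(II, E) →L[ℝ] C(II, G) :=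
  LinearMap.mkContinuous₂
    (LinearMap.mk₂ ℝ (fun (A : C(II, E →L[ℝ] G)) (δ : C(II, E)) => (⟨fun t => A t (δ t), by fun_prop⟩ : C(II, G)))
      (by intros; ext; simp) (by intros; ext; simp) (by intros; ext; simp) (by intros; ext; simp)) 1
    (by
      intro A δ
      rw [one_mul, ContinuousMap.norm_le _ (by positivity)]
      intro t
      exact (A t).le_of_opNorm_le_of_le (A.norm_coe_le_norm t) (δ.norm_coe_le_norm t))

lemma ptw_apply {E G : Type*} [NormedAddCommGroup E] [NormedSpace ℝ E] [NormedAddCommGroup G] [NormedSpace ℝ G]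
    (A : C(II, E →L[ℝ] G)) (δ : C(II, E)) (t : II) : ptw E G A δ t = A t (δ t) := rfl

lemma nem_hasFDerivAt {E G : Type*} [NormedAddCommGroup E] [NormedSpace ℝ E] [NormedAddCommGroup G] [NormedSpace ℝ G]
    (f : C(E, G)) (f' : C(E, E →L[ℝ] G)) (hf : ∀ x, HasFDerivAt f (f' x) x) (γ : C(II, E)) :
    HasFDerivAt (fun γ : C(II, E) => f.comp γ) (ptw E G (f'.comp γ)) γ := by
  rw [hasFDerivAt_iff_isLittleO, Asymptotics.isLittleO_iff]
  intro ε hε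
  have hc : Continuous (fun γ : C(II, E) => f'.comp γ) := ContinuousMap.continuous_postcomp f'
  obtain ⟨r, hr, h⟩ := (Metric.continuous_iff (α := C(II, E)) (β := C(II, E →L[ℝ] G))).1 hc γ ε hε
  filter_upwards [Metric.ball_mem_nhds γ hr] with δ hδ
  rw [ContinuousMap.norm_le _ (by positivity)]
  intro t
  have hb : ∀ y ∈ Metric.ball (γ t) r, ‖f' y - f' (γ t)‖ ≤ ε := by
    intro y hy
    have h1 := h (γ + ContinuousMap.const II (y - γ t)) (by
      rw [dist_eq_norm, add_sub_cancel_left]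
      refine lt_of_le_of_lt ?_ (mem_ball_iff_norm.1 hy)
      rw [ContinuousMap.norm_le _ (by positivity)]
      intro s; simp)
    have h2 := (ContinuousMap.dist_apply_le_dist t).trans h1.le
    simpa [dist_eq_norm] using h2
  have hδt : δ t ∈ Metric.ball (γ t) r := (ContinuousMap.dist_apply_le_dist t).trans_lt hδ
  have := (convex_ball (γ t) r).norm_image_sub_le_of_norm_hasFDerivWithin_le'
    (fun y _ => (hf y).hasFDerivWithinAt) hb (Metric.mem_ball_self hr) hδt
  refine this.trans ?_
  gcongr
  exact (δ - γ).norm_coe_le_norm t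

lemma nem_contDiff_nat {E : Type u} [NormedAddCommGroup E] [NormedSpace ℝ E] (k : ℕ) :
    ∀ {G : Type u} [NormedAddCommGroup G] [NormedSpace ℝ G]
    (f : C(E, G)) (_ : ContDiff ℝ (⊤:ℕ∞) f), ContDiff ℝ k (fun γ : C(II, E) => f.comp γ) := by
  induction k with
  | zero => 
    intro G _ _ f _
    rw [Nat.cast_zero, contDiff_zero]
    exact ContinuousMap.continuous_postcomp f
  | succ k ih =>
    intro G _ _ f hf
    have hd : ContDiff ℝ (⊤:ℕ∞) (fderiv ℝ f) := hf.fderiv_right (by simp)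
    rw [Nat.cast_succ]
    rw [contDiff_succ_iff_hasFDerivAt]
    refine ⟨fun γ => ptw E G ((⟨fderiv ℝ f, hd.continuous⟩ : C(E, E →L[ℝ] G)).comp γ), ?_, ?_⟩
    · have hL : ContDiff ℝ k (fun A : C(II, E →L[ℝ] G) => ptw E G A) :=
        IsBoundedLinearMap.contDiff (𝕜 := ℝ) (E := C(II, E →L[ℝ] G)) (F := C(II, E) →L[ℝ] C(II, G))
          ⟨⟨map_add _, map_smul _⟩, 1, one_pos, fun A => by
            rw [one_mul]
            refine ContinuousLinearMap.opNorm_le_bound _ (by positivity) fun δ => ?_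
            rw [ContinuousMap.norm_le _ (by positivity)]
            intro t
            exact (A t).le_of_opNorm_le_of_le (A.norm_coe_le_norm t) (δ.norm_coe_le_norm t)⟩
      exact hL.comp (ih (⟨fderiv ℝ f, hd.continuous⟩ : C(E, E →L[ℝ] G)) hd)
    · intro γ
      exact nem_hasFDerivAt f _ (fun x => (hf.differentiable (by simp) x).hasFDerivAt) γ

lemma nem_contDiff {E G : Type u} [NormedAddCommGroup E] [NormedSpace ℝ E] [NormedAddCommGroup G] [NormedSpace ℝ G]
    (f : C(E, G)) (hf : ContDiff ℝ (⊤:ℕ∞) f) : ContDiff ℝ (⊤:ℕ∞) (fun γ : C(II, E) => f.comp γ) :=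
  contDiff_infty.2 fun k => nem_contDiff_nat k f hf

/-- inverse function theorem, smooth on a neighbourhood -/
lemma inv_fun {E F : Type*} [NormedAddCommGroup E] [NormedSpace ℝ E] [CompleteSpace E]
    [NormedAddCommGroup F] [NormedSpace ℝ F]
    (f : E → F) (U : Set E) (hU : IsOpen U) (hf : ContDiffOn ℝ (⊤:ℕ∞) f U) (a : E) (ha : a ∈ U)
    (e : E ≃L[ℝ] F) (he : HasFDerivAt f (e : E →L[ℝ] F) a) :
    ∃ h : OpenPartialHomeomorph E F, a ∈ h.source ∧ h.source ⊆ U ∧ (∀ x, h x = f x) ∧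
      ContDiffOn ℝ (⊤:ℕ∞) h.symm h.target := by
  have hfa : ContDiffAt ℝ (⊤:ℕ∞) f a := hf.contDiffAt (hU.mem_nhds ha)
  set h0 := hfa.toOpenPartialHomeomorph f he (by simp)
  have hc : ContinuousOn (fderiv ℝ f) U := hf.continuousOn_fderiv_of_isOpen hU (by simp)
  have hV : IsOpen (U ∩ fderiv ℝ f ⁻¹' range ((↑) : (E ≃L[ℝ] F) → E →L[ℝ] F)) :=
    hc.isOpen_inter_preimage hU ContinuousLinearEquiv.isOpen
  refine ⟨h0.restrOpen _ hV, ⟨hfa.mem_toOpenPartialHomeomorph_source he (by simp), ha, e, he.fderiv.symm⟩,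
    fun x hx => hx.2.1, fun x => rfl, ?_⟩
  intro y hy
  have hs := (h0.restrOpen _ hV).map_target hy
  obtain ⟨e', he'⟩ := hs.2.2
  have hfy := hf.contDiffAt (hU.mem_nhds hs.2.1)
  refine ((h0.restrOpen _ hV).contDiffAt_symm (f₀' := e') hy ?_ hfy).contDiffWithinAt
  rw [he']
  exact (hfy.differentiableAt (by simp)).hasFDerivAt

/-- integration operator -/
noncomputable def intOp (F : Type*) [NormedAddCommGroup F] [NormedSpace ℝ F] [CompleteSpace F] :
    C(II, F) →L[ℝ] C(II, F) :=
  LinearMap.mkContinuous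
    { toFun := fun γ => (⟨fun s => ∫ r in (0:ℝ)..s, γ (projIcc 0 1 zero_le_one r), by
        have : Continuous fun r : ℝ => γ (projIcc 0 1 zero_le_one r) :=
          γ.continuous.comp continuous_projIcc
        exact (intervalIntegral.continuous_primitive (fun a b => this.intervalIntegrable a b) 0).comp
          continuous_subtype_val⟩ : C(II, F))
      map_add' := by
        intro γ δ
        ext s
        have h : ∀ γ : C(II, F), Continuous fun r : ℝ => γ (projIcc 0 1 zero_le_one r) :=
          fun γ => γ.continuous.comp continuous_projIcc
        exact intervalIntegral.integral_add ((h γ).intervalIntegrable _ _) ((h δ).intervalIntegrable _ _)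
      map_smul' := by
        intro c γ
        ext s
        exact intervalIntegral.integral_smul _ _ } 1 (by
      intro γ
      rw [one_mul, ContinuousMap.norm_le _ (by positivity)]
      intro s
      refine (intervalIntegral.norm_integral_le_of_norm_le_const (C := ‖γ‖)
        fun r _ => γ.norm_coe_le_norm _).trans ?_
      have h1 := s.2.1
      have h2 := s.2.2
      rw [sub_zero, abs_of_nonneg h1]
      exact mul_le_of_le_one_right (norm_nonneg _) h2)

lemma intOp_apply {F : Type*} [NormedAddCommGroup F] [NormedSpace ℝ F] [CompleteSpace F] (γ : C(II, F)) (s : II) :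
    intOp F γ s = ∫ r in (0:ℝ)..s, γ (projIcc 0 1 zero_le_one r) := rfl

noncomputable def constL (F : Type*) [NormedAddCommGroup F] [NormedSpace ℝ F] : F →L[ℝ] C(II, F) :=
  LinearMap.mkContinuous
    { toFun := fun x => ContinuousMap.const II x
      map_add' := by intros; rfl
      map_smul' := by intros; rfl } 1 (by
      intro x
      rw [one_mul, ContinuousMap.norm_le _ (by positivity)]
      intro s
      exact le_rfl)

lemma constL_apply {F : Type*} [NormedAddCommGroup F] [NormedSpace ℝ F] (x : F) (s : II) : constL F x s = x := rfl

noncomputable def shearE (F : Type*) [NormedAddCommGroup F] [NormedSpace ℝ F] (w : C(II, F)) :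
    (ℝ × F × C(II, F)) ≃L[ℝ] (ℝ × F × C(II, F)) :=
  ContinuousLinearEquiv.equivOfInverse
    ((ContinuousLinearMap.fst ℝ ℝ (F × C(II, F))).prod
      (((ContinuousLinearMap.fst ℝ F C(II, F)).comp (ContinuousLinearMap.snd ℝ ℝ (F × C(II, F)))).prod
        ((ContinuousLinearMap.snd ℝ F C(II, F)).comp (ContinuousLinearMap.snd ℝ ℝ (F × C(II, F)))
          - (constL F).comp ((ContinuousLinearMap.fst ℝ F C(II, F)).comp (ContinuousLinearMap.snd ℝ ℝ (F × C(II, F))))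
          - (ContinuousLinearMap.fst ℝ ℝ (F × C(II, F))).smulRight w)))
    ((ContinuousLinearMap.fst ℝ ℝ (F × C(II, F))).prod
      (((ContinuousLinearMap.fst ℝ F C(II, F)).comp (ContinuousLinearMap.snd ℝ ℝ (F × C(II, F)))).prod
        ((ContinuousLinearMap.snd ℝ F C(II, F)).comp (ContinuousLinearMap.snd ℝ ℝ (F × C(II, F)))
          + (constL F).comp ((ContinuousLinearMap.fst ℝ F C(II, F)).comp (ContinuousLinearMap.snd ℝ ℝ (F × C(II, F))))
          + (ContinuousLinearMap.fst ℝ ℝ (F × C(II, F))).smulRight w)))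
    (by rintro ⟨t, x, γ⟩; simp; abel) (by rintro ⟨t, x, γ⟩; simp; abel)

/-- local smooth flow -/
lemma local_flow {F : Type*} [NormedAddCommGroup F] [NormedSpace ℝ F] [CompleteSpace F]
    (Z : F → F) (hZ : ContDiff ℝ (⊤:ℕ∞) Z) (x₀ : F) :
    ∃ r > 0, ∃ φ : ℝ × F → F, ContDiffOn ℝ (⊤:ℕ∞) φ (Metric.ball (0, x₀) r) ∧
      (∀ x ∈ Metric.ball x₀ r, φ (0, x) = x) ∧
      ∀ t x, (t, x) ∈ Metric.ball ((0:ℝ), x₀) r → HasDerivAt (fun s => φ (s, x)) (Z (φ (t, x))) t := by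
  let Zc : C(F, F) := ⟨Z, hZ.continuous⟩
  let Φ : ℝ × F × C(II, F) → C(II, F) := fun p => p.2.2 - constL F p.2.1 - p.1 • intOp F (Zc.comp p.2.2)
  let G : ℝ × F × C(II, F) → ℝ × F × C(II, F) := fun p => (p.1, p.2.1, Φ p)
  have hN : ContDiff ℝ (⊤:ℕ∞) (fun γ : C(II, F) => intOp F (Zc.comp γ)) :=
    (intOp F).contDiff.comp (nem_contDiff Zc hZ)
  have hN2 : ContDiff ℝ (⊤:ℕ∞) (fun p : ℝ × F × C(II, F) => intOp F (Zc.comp p.2.2)) :=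
    hN.comp (by fun_prop)
  have hΦ : ContDiff ℝ (⊤:ℕ∞) Φ := by
    dsimp only [Φ]
    fun_prop
  have hG : ContDiff ℝ (⊤:ℕ∞) G := by
    dsimp only [G]; fun_prop
  let p₀ : ℝ × F × C(II, F) := (0, x₀, constL F x₀)
  let w := intOp F (Zc.comp (constL F x₀))
  have hder : HasFDerivAt G (shearE F w : (ℝ × F × C(II, F)) →L[ℝ] (ℝ × F × C(II, F))) p₀ := by
    have h1 : HasFDerivAt (fun p : ℝ × F × C(II, F) => p.1) (ContinuousLinearMap.fst ℝ ℝ (F × C(II, F))) p₀ :=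
      hasFDerivAt_fst
    have h2 : HasFDerivAt (fun p : ℝ × F × C(II, F) => p.2.1)
      ((ContinuousLinearMap.fst ℝ F C(II, F)).comp (ContinuousLinearMap.snd ℝ ℝ (F × C(II, F)))) p₀ :=
      (hasFDerivAt_snd).fst
    have h3 : HasFDerivAt (fun p : ℝ × F × C(II, F) => p.2.2)
      ((ContinuousLinearMap.snd ℝ F C(II, F)).comp (ContinuousLinearMap.snd ℝ ℝ (F × C(II, F)))) p₀ :=
      (hasFDerivAt_snd).snd
    have h4 := (hN2.differentiable (by simp) p₀).hasFDerivAt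
    have h5 := h1.prodMk (h2.prodMk ((h3.sub ((constL F).hasFDerivAt.comp p₀ h2)).sub (h1.smul h4)))
    refine h5.congr_fderiv ?_
    refine ContinuousLinearMap.ext ?_
    rintro ⟨t, x, γ⟩
    simp [shearE, p₀, w]
  obtain ⟨h, h0, -, hhG, hsymm⟩ := inv_fun G univ isOpen_univ hG.contDiffOn p₀ (mem_univ _) _ hder
  obtain ⟨ρ, hρ, hball⟩ := Metric.isOpen_iff.1 h.open_source p₀ h0
  -- the solution map
  let ψ : ℝ × F → C(II, F) := fun q => (h.symm (q.1, q.2, 0)).2.2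
  have hι : Continuous (fun q : ℝ × F => ((q.1, q.2, 0) : ℝ × F × C(II, F))) := by fun_prop
  have hG0 : G p₀ = (0, x₀, 0) := by simp [G, Φ, p₀]
  have ht0 : ((0, x₀, 0) : ℝ × F × C(II, F)) ∈ h.target := by
    rw [← hG0, ← hhG]; exact h.map_source h0
  have hopen : IsOpen ((fun q : ℝ × F => ((q.1, q.2, 0) : ℝ × F × C(II, F))) ⁻¹'
      (h.target ∩ h.symm ⁻¹' Metric.ball p₀ ρ)) :=
    (h.symm.isOpen_inter_preimage Metric.isOpen_ball).preimage hι
  have hs0 : h.symm (0, x₀, 0) = p₀ := by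
    rw [← hG0, ← hhG]; exact h.left_inv h0
  obtain ⟨r, hr, hrb⟩ := Metric.isOpen_iff.1 hopen (0, x₀) (by
    refine ⟨ht0, ?_⟩
    simp only [mem_preimage]
    rw [hs0]; exact Metric.mem_ball_self hρ)
  -- characterisation
  have hψ1 : ∀ q ∈ Metric.ball ((0:ℝ), x₀) r, h.symm (q.1, q.2, 0) = (q.1, q.2, ψ q) ∧
      Φ (q.1, q.2, ψ q) = 0 ∧ dist (ψ q) (constL F x₀) < ρ ∧ dist q.1 0 < ρ ∧ dist q.2 x₀ < ρ := by
    intro q hq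
    obtain ⟨hq1, hq2⟩ := hrb hq
    have e1 : G (h.symm (q.1, q.2, 0)) = (q.1, q.2, 0) := by rw [← hhG]; exact h.right_inv hq1
    have e2 : h.symm (q.1, q.2, 0) = (q.1, q.2, ψ q) := by
      have a1 := congrArg Prod.fst e1
      have a2 := congrArg (fun p => p.2.1) e1
      exact Prod.ext a1 (Prod.ext a2 rfl)
    refine ⟨e2, ?_, ?_⟩
    · rw [e2] at e1
      exact congrArg (fun p => p.2.2) e1
    · have hq2' : h.symm (q.1, q.2, 0) ∈ Metric.ball p₀ ρ := hq2
      rw [e2, Metric.mem_ball, Prod.dist_eq, Prod.dist_eq, max_lt_iff, max_lt_iff] at hq2'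
      exact ⟨hq2'.2.2, hq2'.1, hq2'.2.1⟩
  have huniq : ∀ q ∈ Metric.ball ((0:ℝ), x₀) r, ∀ γ : C(II, F), dist γ (constL F x₀) < ρ →
      Φ (q.1, q.2, γ) = 0 → γ = ψ q := by
    intro q hq γ hγ hγ0
    obtain ⟨-, -, -, d1, d2⟩ := hψ1 q hq
    have hm : (q.1, q.2, γ) ∈ h.source := hball (by
      rw [Metric.mem_ball, Prod.dist_eq, Prod.dist_eq, max_lt_iff, max_lt_iff]
      exact ⟨d1, d2, hγ⟩)
    have e : h (q.1, q.2, γ) = (q.1, q.2, 0) := by rw [hhG]; simp only [G]; rw [hγ0]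
    have := h.left_inv hm
    rw [e] at this
    exact (congrArg (fun p => p.2.2) this).symm
  have hψs : ContDiffOn ℝ (⊤:ℕ∞) ψ (Metric.ball (0, x₀) r) := by
    have : ContDiffOn ℝ (⊤:ℕ∞) (fun q : ℝ × F => h.symm (q.1, q.2, 0)) (Metric.ball (0, x₀) r) :=
      hsymm.comp (t := h.target) (f := fun q : ℝ × F => ((q.1, q.2, 0) : ℝ × F × C(II, F)))
        (ContDiff.contDiffOn (by fun_prop)) (fun q hq => (hrb hq).1)
    exact this.snd.snd
  let one : II := ⟨1, by simp⟩
  let φ : ℝ × F → F := fun q => ψ q one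
  have hφ : ContDiffOn ℝ (⊤:ℕ∞) φ (Metric.ball (0, x₀) r) :=
    (ContinuousLinearMap.contDiff (E := C(II, F)) (F := F)
      (ContinuousMap.evalCLM ℝ one : C(II, F) →L[ℝ] F)).comp_contDiffOn hψs
  have heq : ∀ q ∈ Metric.ball ((0:ℝ), x₀) r, ∀ s : II,
      ψ q s = q.2 + q.1 • ∫ r in (0:ℝ)..s, Z (ψ q (projIcc 0 1 zero_le_one r)) := by
    intro q hq s
    have := (hψ1 q hq).2.1
    have h2 := congrArg (fun γ : C(II, F) => γ s) this
    simp only [Φ, ContinuousMap.sub_apply, ContinuousMap.smul_apply, constL_apply, intOp_apply,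
      ContinuousMap.zero_apply] at h2
    rw [sub_sub, sub_eq_zero] at h2
    exact h2
  -- scaling
  have hscale : ∀ q ∈ Metric.ball ((0:ℝ), x₀) r, ∀ s : II, φ (s * q.1, q.2) = ψ q s := by
    intro q hq s
    have hs1 := s.2.1
    have hs2 := s.2.2
    have hq' : ((s:ℝ) * q.1, q.2) ∈ Metric.ball ((0:ℝ), x₀) r := by
      rw [Metric.mem_ball, Prod.dist_eq, max_lt_iff] at hq ⊢
      refine ⟨lt_of_le_of_lt ?_ hq.1, hq.2⟩
      simp only [dist_zero_right, norm_mul, Real.norm_eq_abs, abs_of_nonneg hs1]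
      exact mul_le_of_le_one_left (abs_nonneg _) hs2
    let m : C(II, II) := ⟨fun t => ⟨s * t, mul_nonneg hs1 t.2.1, mul_le_one₀ hs2 t.2.1 t.2.2⟩, by fun_prop⟩
    have := huniq _ hq' ((ψ q).comp m) ?_ ?_
    · have h2 := congrArg (fun γ : C(II, F) => γ one) this
      change _ = φ (s * q.1, q.2) at h2
      rw [← h2]
      change ψ q (m one) = _
      congr 1
      exact Subtype.ext (mul_one _)
    · refine lt_of_le_of_lt ?_ (hψ1 q hq).2.2.1
      rw [ContinuousMap.dist_le dist_nonneg]
      intro t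
      exact (ContinuousMap.dist_apply_le_dist (f := ψ q) (g := constL F x₀) (m t))
    · ext t
      simp only [Φ, ContinuousMap.sub_apply, ContinuousMap.smul_apply, constL_apply, intOp_apply,
        ContinuousMap.zero_apply]
      rw [sub_sub, sub_eq_zero]
      change ψ q (m t) = _
      rw [heq q hq (m t)]
      congr 1
      rw [mul_comm, mul_smul]
      congr 1
      change (∫ r in (0:ℝ)..(s * t), Z (ψ q (projIcc 0 1 zero_le_one r))) = _
      have := intervalIntegral.smul_integral_comp_mul_left (a := (0:ℝ)) (b := (t:ℝ))
        (fun r => Z (ψ q (projIcc 0 1 zero_le_one r))) (s:ℝ)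
      rw [mul_zero] at this
      rw [← this]
      congr 1
      apply intervalIntegral.integral_congr
      intro u hu
      rw [uIcc_of_le t.2.1] at hu
      have hu1 : u ∈ Icc (0:ℝ) 1 := ⟨hu.1, hu.2.trans t.2.2⟩
      change Z (ψ q _) = Z (ψ q (m _))
      rw [projIcc_of_mem _ hu1, projIcc_of_mem _ ⟨mul_nonneg hs1 hu.1, mul_le_one₀ hs2 hu.1 hu1.2⟩]
      rfl
  have hdiff : ∀ t x, (t, x) ∈ Metric.ball ((0:ℝ), x₀) r → DifferentiableAt ℝ (fun s => φ (s, x)) t := by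
    intro t x hq
    have h1 : DifferentiableAt ℝ φ (t, x) :=
      (hφ.contDiffAt (Metric.isOpen_ball.mem_nhds hq)).differentiableAt (by simp)
    exact h1.comp (f := fun s : ℝ => (s, x)) t (by fun_prop)
  have hne : ∀ t x, (t, x) ∈ Metric.ball ((0:ℝ), x₀) r → t ≠ 0 →
      HasDerivAt (fun s => φ (s, x)) (Z (φ (t, x))) t := by
    intro t x hq ht
    have h1 := (hdiff t x hq).hasDerivAt
    have h2 : HasDerivAt (fun s : ℝ => φ (s * t, x)) (t • deriv (fun s => φ (s, x)) t) 1 := by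
      have h3 : HasDerivAt (fun s : ℝ => s * t) t 1 := by simpa using (hasDerivAt_id (1:ℝ)).mul_const t
      exact HasDerivAt.scomp (h := fun s : ℝ => s * t) (g₁ := fun s => φ (s, x)) 1 (by simpa using h1) h3
    have hcont : Continuous fun r : ℝ => Z (ψ (t, x) (projIcc 0 1 zero_le_one r)) :=
      hZ.continuous.comp ((ψ (t, x)).continuous.comp continuous_projIcc)
    have h4 : HasDerivAt (fun s : ℝ => x + t • ∫ r in (0:ℝ)..s, Z (ψ (t, x) (projIcc 0 1 zero_le_one r)))
        (t • Z (ψ (t, x) (projIcc 0 1 zero_le_one 1))) 1 :=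
      ((hcont.integral_hasStrictDerivAt 0 1).hasDerivAt.const_smul t).const_add x
    have h5 : HasDerivWithinAt (fun s : ℝ => φ (s * t, x)) (t • Z (ψ (t, x) (projIcc 0 1 zero_le_one 1)))
        (Icc 0 1) 1 := by
      refine h4.hasDerivWithinAt.congr_of_mem ?_ (by simp)
      intro s hs
      rw [hscale (t, x) hq ⟨s, hs⟩, heq (t, x) hq ⟨s, hs⟩]
    have h6 := ((uniqueDiffOn_Icc (zero_lt_one : (0:ℝ) < 1)) 1 (by simp)).eq_deriv _ h2.hasDerivWithinAt h5
    have h7 := smul_right_injective F ht h6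
    rw [h7] at h1
    rw [projIcc_right] at h1
    exact h1
  refine ⟨r, hr, φ, hφ, ?_, ?_⟩
  · intro x hx
    have hq : ((0:ℝ), x) ∈ Metric.ball ((0:ℝ), x₀) r := by
      rw [Metric.mem_ball, Prod.dist_eq, max_lt_iff]; exact ⟨by simpa using hr, hx⟩
    have := heq (0, x) hq one
    simpa using this
  · intro t x hq
    by_cases ht : t = 0
    · subst ht
      have hnear : ∀ᶠ s in 𝓝 (0:ℝ), (s, x) ∈ Metric.ball ((0:ℝ), x₀) r :=
        (Continuous.tendsto (f := fun s : ℝ => (s, x)) (by fun_prop) 0).eventually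
          (Metric.isOpen_ball.mem_nhds hq)
      have hc : ContinuousAt (fun s => φ (s, x)) 0 := (hdiff 0 x hq).continuousAt
      have hf1 : ContDiffAt ℝ (⊤:ℕ∞) (fun s => φ (s, x)) 0 :=
        (hφ.contDiffAt (Metric.isOpen_ball.mem_nhds hq)).comp (f := fun s : ℝ => (s, x)) 0 (by fun_prop)
      have hd : ContinuousAt (deriv (fun s => φ (s, x))) 0 := by
        have h1 : ContDiffAt ℝ 0 (fderiv ℝ (fun s => φ (s, x))) 0 := hf1.fderiv_right (by simp)
        have h2 : ContinuousAt (fun s => fderiv ℝ (fun s => φ (s, x)) s 1) 0 :=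
          h1.continuousAt.clm_apply continuousAt_const
        exact h2
      have e : deriv (fun s => φ (s, x)) =ᶠ[𝓝[≠] (0:ℝ)] fun s => Z (φ (s, x)) := by
        filter_upwards [hnear.filter_mono nhdsWithin_le_nhds, self_mem_nhdsWithin] with s hs hs0
        exact (hne s x hs hs0).deriv
      have l1 := hd.tendsto.mono_left (nhdsWithin_le_nhds (s := {0}ᶜ))
      have l2 : Tendsto (fun s => Z (φ (s, x))) (𝓝[≠] (0:ℝ)) (𝓝 (Z (φ (0, x)))) :=
        (hZ.continuous.continuousAt.comp hc).tendsto.mono_left nhdsWithin_le_nhds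
      have e2 := tendsto_nhds_unique (l1.congr' e) l2
      rw [← e2]
      exact (hdiff 0 x hq).hasDerivAt
    · exact hne t x hq ht

lemma flow_box {E : Type*} [NormedAddCommGroup E] [NormedSpace ℝ E] [CompleteSpace E]
    (X : E → E) (hX : ContDiff ℝ (⊤:ℕ∞) X) (h : E → ℝ) (hh : ContDiff ℝ (⊤:ℕ∞) h) (x₀ : E) (h0 : X x₀ ≠ 0) :
    ∃ U : Set E, IsOpen U ∧ x₀ ∈ U ∧ ∃ u : E → ℝ, ContDiffOn ℝ (⊤:ℕ∞) u U ∧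
      ∀ x ∈ U, fderiv ℝ u x (X x) = h x := by
  obtain ⟨r, hr, φ, hφ, hφ0, hφd⟩ := local_flow (fun p : E × ℝ => (X p.1, h p.1)) (by fun_prop) (x₀, 0)
  obtain ⟨ℓ, hℓ⟩ : ∃ ℓ : E →L[ℝ] ℝ, ℓ (X x₀) = 1 := by
    obtain ⟨ℓ, -, hℓ⟩ := exists_dual_vector ℝ (X x₀) (norm_ne_zero_iff.2 h0)
    refine ⟨‖X x₀‖⁻¹ • ℓ, ?_⟩
    have : ‖X x₀‖ ≠ 0 := norm_ne_zero_iff.2 h0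
    simp [hℓ, this]
  set v := X x₀ with hv
  let ι : E → ℝ × (E × ℝ) := fun y => (ℓ y, (x₀ + y - ℓ y • v, 0))
  have hι : ContDiff ℝ (⊤:ℕ∞) ι := by dsimp only [ι]; fun_prop
  let V : Set E := ι ⁻¹' Metric.ball (0, (x₀, 0)) r
  have hV : IsOpen V := Metric.isOpen_ball.preimage hι.continuous
  have h0V : (0:E) ∈ V := by
    have : ι 0 = (0, (x₀, 0)) := by simp [ι]
    simp only [V, mem_preimage, this]
    exact Metric.mem_ball_self hr
  have hP : ContDiffOn ℝ (⊤:ℕ∞) (fun y => φ (ι y)) V := hφ.comp hι.contDiffOn (fun y hy => hy)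
  have hPd : ∀ y ∈ V, DifferentiableAt ℝ (fun y => φ (ι y)) y := fun y hy =>
    (hP.contDiffAt (hV.mem_nhds hy)).differentiableAt (by simp)
  -- derivative along v
  have hdv : ∀ y ∈ V, fderiv ℝ (fun y => φ (ι y)) y v = (X (φ (ι y)).1, h (φ (ι y)).1) := by
    intro y hy
    have h1 := hφd (ℓ y) (x₀ + y - ℓ y • v, 0) hy
    have h2 : HasDerivAt (fun s : ℝ => φ (ι (y + s • v))) (fderiv ℝ (fun y => φ (ι y)) y v) 0 := by
      have h3 : HasDerivAt (fun s : ℝ => y + s • v) v 0 := by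
        simpa using ((hasDerivAt_id (0:ℝ)).smul_const v).const_add y
      exact HasFDerivAt.comp_hasDerivAt (l := fun y => φ (ι y)) (f := fun s : ℝ => y + s • v) 0
        (by simpa using (hPd y hy).hasFDerivAt) h3
    have h4 : HasDerivAt (fun s : ℝ => φ (ι (y + s • v))) (X (φ (ι y)).1, h (φ (ι y)).1) 0 := by
      have e : (fun s : ℝ => φ (ι (y + s • v))) = fun s : ℝ => φ (ℓ y + s, (x₀ + y - ℓ y • v, 0)) := by
        funext s
        simp only [ι, map_add, map_smul, hℓ, smul_eq_mul, mul_one, add_smul]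
        congr 3
        abel
      rw [e]
      have h5 : HasDerivAt (fun s : ℝ => ℓ y + s) 1 0 := (hasDerivAt_id (0:ℝ)).const_add _
      have := HasDerivAt.scomp (h := fun s : ℝ => ℓ y + s) (g₁ := fun s => φ (s, (x₀ + y - ℓ y • v, 0))) 0
        (by simpa using h1) h5
      simpa [Function.comp_def] using this
    exact h2.unique h4
  let Ψ : E → E := fun y => (φ (ι y)).1
  let W : E → ℝ := fun y => (φ (ι y)).2
  have hΨ : ContDiffOn ℝ (⊤:ℕ∞) Ψ V := hP.fst
  have hW : ContDiffOn ℝ (⊤:ℕ∞) W V := hP.snd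
  have hΨd : ∀ y ∈ V, HasFDerivAt Ψ ((ContinuousLinearMap.fst ℝ E ℝ).comp (fderiv ℝ (fun y => φ (ι y)) y)) y :=
    fun y hy => (hPd y hy).hasFDerivAt.fst
  have hWd : ∀ y ∈ V, HasFDerivAt W ((ContinuousLinearMap.snd ℝ E ℝ).comp (fderiv ℝ (fun y => φ (ι y)) y)) y :=
    fun y hy => (hPd y hy).hasFDerivAt.snd
  have hφx : ∀ z : E × ℝ, z ∈ Metric.ball (x₀, (0:ℝ)) r → φ (0, z) = z := hφ0
  have hΨ0 : Ψ 0 = x₀ := by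
    have := hφx (x₀, 0) (Metric.mem_ball_self hr)
    simp [Ψ, ι, this]
  have hder0 : HasFDerivAt Ψ ((ContinuousLinearEquiv.refl ℝ E : E ≃L[ℝ] E) : E →L[ℝ] E) 0 := by
    refine (hΨd 0 h0V).congr_fderiv ?_
    -- on ker ℓ
    have hker : ∀ z : E, ℓ z = 0 → fderiv ℝ (fun y => φ (ι y)) 0 z = (z, 0) := by
      intro z hz
      have h2 : HasDerivAt (fun s : ℝ => φ (ι (s • z))) (fderiv ℝ (fun y => φ (ι y)) 0 z) 0 := by
        have h3 : HasDerivAt (fun s : ℝ => s • z) z 0 := by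
          simpa using ((hasDerivAt_id (0:ℝ)).smul_const z)
        exact HasFDerivAt.comp_hasDerivAt (l := fun y => φ (ι y)) (f := fun s : ℝ => s • z) 0
          (by simpa using (hPd 0 h0V).hasFDerivAt) h3
      have h4 : HasDerivAt (fun s : ℝ => (x₀ + s • z, (0:ℝ))) (z, 0) 0 := by
        refine HasDerivAt.prodMk ?_ (hasDerivAt_const _ _)
        simpa using ((hasDerivAt_id (0:ℝ)).smul_const z).const_add x₀
      refine h2.unique (h4.congr_of_eventuallyEq ?_)
      have hc : Continuous (fun s : ℝ => (x₀ + s • z, (0:ℝ))) := by fun_prop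
      have : ∀ᶠ s in 𝓝 (0:ℝ), (x₀ + s • z, (0:ℝ)) ∈ Metric.ball (x₀, (0:ℝ)) r :=
        hc.continuousAt.eventually (Metric.isOpen_ball.mem_nhds (by simpa using hr))
      filter_upwards [this] with s hs
      have := hφx _ hs
      simpa [ι, hz] using this
    ext y
    have e : y = (y - ℓ y • v) + ℓ y • v := by abel
    have h1 := hker (y - ℓ y • v) (by simp [hℓ])
    have h2 := hdv 0 h0V
    have h3 : (φ (ι 0)).1 = x₀ := hΨ0
    rw [h3, ← hv] at h2
    change (fderiv ℝ (fun y => φ (ι y)) 0 y).1 = y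
    conv_lhs => rw [e]
    rw [map_add, map_smul, h1, h2]
    simp
  obtain ⟨H, hH0, hHV, hHΨ, hHs⟩ := inv_fun Ψ V hV hΨ 0 h0V _ hder0
  refine ⟨H.target, H.open_target, ?_, fun x => W (H.symm x), ?_, ?_⟩
  · rw [← hΨ0, ← hHΨ]; exact H.map_source hH0
  · exact hW.comp hHs (fun x hx => hHV (H.map_target hx))
  · intro x hx
    have hy := H.map_target hx
    have hyV := hHV hy
    set y := H.symm x with hydef
    have hxy : Ψ y = x := by rw [← hHΨ]; exact H.right_inv hx
    have hu : DifferentiableAt ℝ (fun x => W (H.symm x)) x :=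
      ((hW.comp hHs (fun x hx => hHV (H.map_target hx))).contDiffAt (H.open_target.mem_nhds hx)).differentiableAt
        (by simp)
    have hc : HasFDerivAt (fun z => W (H.symm (Ψ z)))
        ((fderiv ℝ (fun x => W (H.symm x)) x).comp
          ((ContinuousLinearMap.fst ℝ E ℝ).comp (fderiv ℝ (fun y => φ (ι y)) y))) y :=
      HasFDerivAt.comp (g := fun x => W (H.symm x)) (f := Ψ) y (by rw [hxy]; exact hu.hasFDerivAt) (hΨd y hyV)
    have hW' : HasFDerivAt (fun z => W (H.symm (Ψ z))) _ y := (hWd y hyV).congr_of_eventuallyEq (by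
      filter_upwards [H.open_source.mem_nhds hy] with z hz
      rw [← hHΨ, H.left_inv hz])
    have e := congrArg (fun A : E →L[ℝ] ℝ => A v) (hc.unique hW')
    simp only [ContinuousLinearMap.comp_apply, hdv y hyV] at e
    have h3 : (φ (ι y)).1 = x := hxy
    rw [h3] at e
    exact e

/-- base case of the Modified Frobenius Theorem by rescaling:
two pointwise linearly independent vector fields whose Lie bracket lies in
their span can locally be individually rescaled so as to commute. -/
theorem stmt_7 (n : ℕ)
    (X Y : (Fin n → ℝ) → (Fin n → ℝ))
    (hX : ContDiff ℝ (⊤ : ℕ∞) X) (hY : ContDiff ℝ (⊤ : ℕ∞) Y)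
    (hindep : ∀ x : Fin n → ℝ, LinearIndependent ℝ ![X x, Y x])
    (a b : (Fin n → ℝ) → ℝ) (ha : ContDiff ℝ (⊤ : ℕ∞) a) (hb : ContDiff ℝ (⊤ : ℕ∞) b)
    (hbra : ∀ x : Fin n → ℝ,
      VectorField.lieBracket ℝ X Y x = a x • X x + b x • Y x) :
    ∀ x₀ : Fin n → ℝ, ∃ U : Set (Fin n → ℝ), IsOpen U ∧ x₀ ∈ U ∧
      ∃ f g : (Fin n → ℝ) → ℝ,
        ContDiffOn ℝ (⊤ : ℕ∞) f U ∧ ContDiffOn ℝ (⊤ : ℕ∞) g U ∧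
        (∀ x ∈ U, f x ≠ 0) ∧ (∀ x ∈ U, g x ≠ 0) ∧
        ∀ x ∈ U, VectorField.lieBracket ℝ
          (fun y => f y • X y) (fun y => g y • Y y) x = 0 := by
  intro x₀
  have hX0 : X x₀ ≠ 0 := (hindep x₀).ne_zero 0
  have hY0 : Y x₀ ≠ 0 := (hindep x₀).ne_zero 1
  obtain ⟨U, hU, hxU, u, hu, hue⟩ := flow_box Y hY a ha x₀ hY0
  obtain ⟨V, hV, hxV, w, hw, hwe⟩ := flow_box X hX (fun x => - b x) hb.neg x₀ hX0
  refine ⟨U ∩ V, hU.inter hV, ⟨hxU, hxV⟩, fun x => Real.exp (u x), fun x => Real.exp (w x),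
    (hu.mono inter_subset_left).exp, (hw.mono inter_subset_right).exp,
    fun x _ => Real.exp_ne_zero _, fun x _ => Real.exp_ne_zero _, ?_⟩
  rintro x ⟨hx1, hx2⟩
  have hud : HasFDerivAt u (fderiv ℝ u x) x :=
    ((hu.contDiffAt (hU.mem_nhds hx1)).differentiableAt (by simp)).hasFDerivAt
  have hwd : HasFDerivAt w (fderiv ℝ w x) x :=
    ((hw.contDiffAt (hV.mem_nhds hx2)).differentiableAt (by simp)).hasFDerivAt
  have hXd : HasFDerivAt X (fderiv ℝ X x) x := (hX.differentiable (by simp) x).hasFDerivAt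
  have hYd : HasFDerivAt Y (fderiv ℝ Y x) x := (hY.differentiable (by simp) x).hasFDerivAt
  have h1 := (hud.exp.smul hXd).fderiv
  have h2 := (hwd.exp.smul hYd).fderiv
  have h3 := hbra x
  have h4 := hue x hx1
  have h5 := hwe x hx2
  rw [VectorField.lieBracket] at h3 ⊢
  have h1' : fderiv ℝ (fun y => Real.exp (u y) • X y) x = _ := h1
  have h2' : fderiv ℝ (fun y => Real.exp (w y) • Y y) x = _ := h2
  rw [h1', h2']
  have h6 : fderiv ℝ Y x (X x) = a x • X x + b x • Y x + fderiv ℝ X x (Y x) := by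
    rw [← h3]; abel
  simp only [add_apply, smul_apply,
    ContinuousLinearMap.smulRight_apply, map_smul, h4, h5, h6]
  module
end

section
/- Let X₁,…,X_r be smooth vector fields on a q-dimensional manifold N with X₁ ∧ … ∧ X_r ≠ 0 everywhere and [Xᵢ,Xⱼ] = hᵢⱼⁱ Xᵢ + hᵢⱼʲ Xⱼ for smooth functions hᵢⱼᵏ (i.e., each bracket lies in the span of the two fields involved). Then locally there exist nowhere-vanishing smooth functions f₁,…,f_r such that [fᵢXᵢ, fⱼXⱼ] = 0 for all i, j. -/
open Set Filter Topology

section Superposition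

/-- Pointwise application of a continuous family of operators. -/
noncomputable def sfApp (K E G : Type) [TopologicalSpace K] [CompactSpace K]
    [NormedAddCommGroup E] [NormedSpace ℝ E] [NormedAddCommGroup G] [NormedSpace ℝ G] :
    C(K, E →L[ℝ] G) →L[ℝ] C(K, E) →L[ℝ] C(K, G) :=
  LinearMap.mkContinuous₂
    (LinearMap.mk₂ ℝ (fun (A : C(K, E →L[ℝ] G)) (h : C(K, E)) =>
      (⟨fun t => A t (h t), by fun_prop⟩ : C(K, G)))
      (by intros; ext; simp) (by intros; ext; simp) (by intros; ext; simp) (by intros; ext; simp))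
    1 (by
      intro A h
      rw [ContinuousMap.norm_le _ (by positivity)]
      intro t
      simp only [LinearMap.mk₂_apply, ContinuousMap.coe_mk, one_mul]
      refine (ContinuousLinearMap.le_opNorm _ _).trans ?_
      gcongr
      · exact A.norm_coe_le_norm t
      · exact h.norm_coe_le_norm t)

lemma sfApp_apply {K E G : Type} [TopologicalSpace K] [CompactSpace K]
    [NormedAddCommGroup E] [NormedSpace ℝ E] [NormedAddCommGroup G] [NormedSpace ℝ G]
    (A : C(K, E →L[ℝ] G)) (h : C(K, E)) (t : K) : sfApp K E G A h t = A t (h t) := rfl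

lemma sf_hasFDerivAt {K E G : Type} [TopologicalSpace K] [CompactSpace K]
    [NormedAddCommGroup E] [NormedSpace ℝ E] [NormedAddCommGroup G] [NormedSpace ℝ G]
    (F : C(E, G)) (F' : C(E, E →L[ℝ] G)) (hF : ∀ x, HasFDerivAt F (F' x) x) (γ : C(K, E)) :
    HasFDerivAt (fun γ : C(K, E) => F.comp γ) (sfApp K E G (F'.comp γ)) γ := by
  rw [hasFDerivAt_iff_isLittleO_nhds_zero, Asymptotics.isLittleO_iff]
  intro c hc
  have hcont : Continuous (fun γ : C(K, E) => F'.comp γ) := ContinuousMap.continuous_postcomp F'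
  obtain ⟨δ, hδ, hd⟩ :=
    (Metric.continuous_iff (α := C(K, E)) (β := C(K, E →L[ℝ] G))).1 hcont γ c hc
  filter_upwards [Metric.ball_mem_nhds (0 : C(K, E)) hδ] with h hh
  rw [mem_ball_zero_iff] at hh
  rw [ContinuousMap.norm_le _ (by positivity)]
  intro t
  have key := Convex.norm_image_sub_le_of_norm_hasFDerivWithin_le' (𝕜 := ℝ) (f := F) (C := c)
    (s := segment ℝ (γ t) (γ t + h t)) (x := γ t) (y := γ t + h t) (f' := F') (φ := F' (γ t))
    (fun x _ => (hF x).hasFDerivWithinAt) ?_ (convex_segment _ _) (left_mem_segment _ _ _)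
    (right_mem_segment _ _ _)
  · rw [add_sub_cancel_left] at key
    refine le_trans key ?_
    gcongr
    exact h.norm_coe_le_norm t
  · intro x hx
    rw [segment_eq_image'] at hx
    obtain ⟨θ, hθ, rfl⟩ := hx
    have h1 : dist (γ + θ • h) γ < δ := by
      rw [dist_eq_norm, add_sub_cancel_left, norm_smul, Real.norm_eq_abs, abs_of_nonneg hθ.1]
      calc θ * ‖h‖ ≤ 1 * ‖h‖ := by gcongr; exact hθ.2
        _ < δ := by simpa using hh
    have h2 := hd _ h1
    have h3 := (ContinuousMap.dist_apply_le_dist (f := F'.comp (γ + θ • h)) (g := F'.comp γ) t)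
    have h4 := h3.trans h2.le
    rw [dist_eq_norm] at h4
    beta_reduce
    rw [add_sub_cancel_left]
    exact h4

lemma sf_contDiff_nat {K E : Type} [TopologicalSpace K] [CompactSpace K]
    [NormedAddCommGroup E] [NormedSpace ℝ E] (n : ℕ) :
    ∀ {G : Type} [NormedAddCommGroup G] [NormedSpace ℝ G] (F : C(E, G)),
      ContDiff ℝ n F → ContDiff ℝ n (fun γ : C(K, E) => F.comp γ) := by
  induction n with
  | zero =>
    intro G _ _ F _
    have := ContinuousMap.continuous_postcomp (X := K) F
    exact contDiff_zero.2 this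
  | succ n ih =>
    intro G _ _ F hF
    push_cast at hF ⊢
    rw [contDiff_succ_iff_hasFDerivAt] at hF ⊢
    obtain ⟨F', hF', hd⟩ := hF
    refine ⟨fun γ => sfApp K E G ((⟨F', hF'.continuous⟩ : C(E, E →L[ℝ] G)).comp γ), ?_, ?_⟩
    · exact (sfApp K E G).contDiff.comp (ih ⟨F', hF'.continuous⟩ hF')
    · intro γ
      exact sf_hasFDerivAt F ⟨F', hF'.continuous⟩ hd γ

lemma sf_contDiff {K E G : Type} [TopologicalSpace K] [CompactSpace K]
    [NormedAddCommGroup E] [NormedSpace ℝ E] [NormedAddCommGroup G] [NormedSpace ℝ G]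
    (F : C(E, G)) (hF : ContDiff ℝ (⊤ : ℕ∞) F) :
    ContDiff ℝ (⊤ : ℕ∞) (fun γ : C(K, E) => F.comp γ) := by
  rw [contDiff_infty] at hF ⊢
  exact fun n => sf_contDiff_nat n F (hF n)

/-- Integration operator on continuous paths. -/
noncomputable def sfInt (E : Type) [NormedAddCommGroup E] [NormedSpace ℝ E] :
    C(Icc (0:ℝ) 1, E) →L[ℝ] C(Icc (0:ℝ) 1, E) :=
  LinearMap.mkContinuous
    { toFun := fun γ => ⟨fun t => ∫ τ in (0:ℝ)..t, γ (projIcc 0 1 zero_le_one τ), by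
        have : Continuous (fun τ : ℝ => γ (projIcc 0 1 zero_le_one τ)) := by fun_prop
        exact (intervalIntegral.continuous_primitive
          (fun a b => this.intervalIntegrable a b) 0).comp continuous_subtype_val⟩
      map_add' := by
        intro a b
        ext t
        have ha : Continuous (fun τ : ℝ => a (projIcc 0 1 zero_le_one τ)) := by fun_prop
        have hb : Continuous (fun τ : ℝ => b (projIcc 0 1 zero_le_one τ)) := by fun_prop
        simp only [ContinuousMap.add_apply, ContinuousMap.coe_mk]
        exact intervalIntegral.integral_add (ha.intervalIntegrable _ _) (hb.intervalIntegrable _ _)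
      map_smul' := by
        intro c a
        ext t
        simp }
    1 (by
      intro γ
      rw [ContinuousMap.norm_le _ (by positivity)]
      intro t
      have := intervalIntegral.norm_integral_le_of_norm_le_const (a := 0) (b := (t:ℝ)) (C := ‖γ‖)
        (f := fun τ : ℝ => γ (projIcc 0 1 zero_le_one τ)) (fun x _ => γ.norm_coe_le_norm _)
      refine le_trans this ?_
      rw [sub_zero, abs_of_nonneg t.2.1, mul_comm]
      gcongr
      exact t.2.2)

lemma sfInt_apply {E : Type} [NormedAddCommGroup E] [NormedSpace ℝ E]
    (γ : C(Icc (0:ℝ) 1, E)) (t : Icc (0:ℝ) 1) :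
    sfInt E γ t = ∫ τ in (0:ℝ)..t, γ (projIcc 0 1 zero_le_one τ) := rfl

end Superposition

lemma sf_inverse {E F : Type} [NormedAddCommGroup E] [NormedSpace ℝ E] [CompleteSpace E]
    [NormedAddCommGroup F] [NormedSpace ℝ F] (f : E → F) (O : Set E) (hO : IsOpen O) (a : E)
    (ha : a ∈ O) (hf : ContDiffOn ℝ (⊤ : ℕ∞) f O) (f' : E ≃L[ℝ] F)
    (hf' : HasFDerivAt f (f' : E →L[ℝ] F) a) :
    ∃ (g : F → E) (V : Set F), IsOpen V ∧ f a ∈ V ∧ ContDiffOn ℝ (⊤ : ℕ∞) g V ∧ g (f a) = a ∧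
      (∀ y ∈ V, g y ∈ O ∧ f (g y) = y) ∧ (∀ᶠ x in 𝓝 a, g (f x) = x) := by
  have hca : ContDiffAt ℝ (⊤ : ℕ∞) f a := hf.contDiffAt (hO.mem_nhds ha)
  set e := hca.toOpenPartialHomeomorph f hf' (by simp) with he
  have hecoe : (e : E → F) = f := rfl
  have hae : a ∈ e.source := hca.mem_toOpenPartialHomeomorph_source hf' (by simp)
  have hcont : ContinuousOn (fderiv ℝ f) O := hf.continuousOn_fderiv_of_isOpen hO (by simp)
  have hW : IsOpen (O ∩ fderiv ℝ f ⁻¹' range ContinuousLinearEquiv.toContinuousLinearMap) :=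
    hcont.isOpen_inter_preimage hO ContinuousLinearEquiv.isOpen
  set W := O ∩ fderiv ℝ f ⁻¹' range ContinuousLinearEquiv.toContinuousLinearMap with hWdef
  have haW : a ∈ W := ⟨ha, by rw [mem_preimage, hf'.fderiv]; exact ⟨f', rfl⟩⟩
  have hleft : e.symm (f a) = a := e.left_inv hae
  refine ⟨e.symm, e.target ∩ e.symm ⁻¹' W, e.isOpen_inter_preimage_symm hW,
    ⟨e.map_source hae, by rw [mem_preimage, hleft]; exact haW⟩, ?_, hleft, ?_, ?_⟩
  · intro y hy
    obtain ⟨hy1, hy2⟩ := hy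
    obtain ⟨h3, ⟨f₁, h4⟩⟩ := hy2
    have h5 : ContDiffAt ℝ (⊤ : ℕ∞) f (e.symm y) := hf.contDiffAt (hO.mem_nhds h3)
    refine (e.contDiffAt_symm (f₀' := f₁) hy1 ?_ h5).contDiffWithinAt
    rw [h4]
    exact (h5.differentiableAt (by simp)).hasFDerivAt
  · exact fun y hy => ⟨hy.2.1, e.right_inv hy.1⟩
  · filter_upwards [e.open_source.mem_nhds hae] with x hx
    exact e.left_inv hx

lemma sf_extend {E F : Type} [NormedAddCommGroup E] [NormedSpace ℝ E] [FiniteDimensional ℝ E]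
    [NormedAddCommGroup F] [NormedSpace ℝ F] (f : E → F) (O : Set E) (hO : IsOpen O) (a : E)
    (ha : a ∈ O) (hf : ContDiffOn ℝ (⊤ : ℕ∞) f O) :
    ∃ g : E → F, ContDiff ℝ (⊤ : ℕ∞) g ∧ ∀ᶠ x in 𝓝 a, g x = f x := by
  obtain ⟨ε, hε, hb⟩ := Metric.isOpen_iff.1 hO a ha
  let χ : ContDiffBump a := ⟨ε / 4, ε / 2, by linarith, by linarith⟩
  refine ⟨fun x => χ x • f x, ?_, ?_⟩
  · rw [contDiff_iff_contDiffAt]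
    intro x
    by_cases hx : x ∈ O
    · exact χ.contDiff.contDiffAt.smul (hf.contDiffAt (hO.mem_nhds hx))
    · have : x ∉ tsupport χ := by
        rw [χ.tsupport_eq]
        intro h
        apply hx; apply hb
        exact Metric.closedBall_subset_ball (by change ε / 2 < ε; linarith) h
      have h2 : (fun x => χ x • f x) =ᶠ[𝓝 x] fun _ => 0 := by
        filter_upwards [notMem_tsupport_iff_eventuallyEq.1 this] with y hy
        simp [hy]
      exact contDiffAt_const.congr_of_eventuallyEq h2
  · filter_upwards [χ.eventuallyEq_one] with x hx
    simp [hx]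

/-- Simultaneous flow box. -/
lemma sf_flow {E E₁ : Type} [NormedAddCommGroup E] [NormedSpace ℝ E] [CompleteSpace E]
    [NormedAddCommGroup E₁] [NormedSpace ℝ E₁] [CompleteSpace E₁] {m : ℕ}
    (Y : Fin m → E₁ → E₁) (hY : ∀ i, ContDiff ℝ (⊤ : ℕ∞) (Y i)) (p : E₁)
    (hcomm : ∀ᶠ z in 𝓝 p, ∀ i j, fderiv ℝ (Y i) z (Y j z) = fderiv ℝ (Y j) z (Y i z))
    (S : E →L[ℝ] E₁) (T : Fin m → E →L[ℝ] ℝ) (v : Fin m → E)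
    (hT : ∀ i j, T i (v j) = if i = j then 1 else 0) (hS : ∀ i, S (v i) = 0) :
    ∃ (Γ : E → E₁) (V : Set E), IsOpen V ∧ (0 : E) ∈ V ∧ ContDiffOn ℝ (⊤ : ℕ∞) Γ V ∧ Γ 0 = p ∧
      (∀ y, fderiv ℝ Γ 0 y = S y + ∑ i, T i y • Y i p) ∧
      (∀ y ∈ V, ∀ i, fderiv ℝ Γ y (v i) = Y i (Γ y)) := by
  let Yc : Fin m → C(E₁, E₁) := fun i => ⟨Y i, (hY i).continuous⟩
  have hY' : ∀ i, Continuous (fderiv ℝ (Y i)) := fun i => (hY i).continuous_fderiv (by simp)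
  let Yd : Fin m → C(E₁, E₁ →L[ℝ] E₁) := fun i => ⟨fderiv ℝ (Y i), hY' i⟩
  let N : Fin m → C(Icc (0:ℝ) 1, E₁) → C(Icc (0:ℝ) 1, E₁) := fun i γ => (Yc i).comp γ
  have hN : ∀ i, ContDiff ℝ (⊤ : ℕ∞) (N i) := fun i => sf_contDiff (Yc i) (hY i)
  have hNd : ∀ i γ, HasFDerivAt (N i) (sfApp _ _ _ ((Yd i).comp γ)) γ := fun i γ =>
    sf_hasFDerivAt (Yc i) (Yd i) (fun x => ((hY i).differentiable (by simp) x).hasFDerivAt) γ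
  let J := sfInt E₁
  let cst : E₁ →L[ℝ] C(Icc (0:ℝ) 1, E₁) := ContinuousLinearMap.const ℝ (Icc (0:ℝ) 1)
  let R : E × C(Icc (0:ℝ) 1, E₁) → C(Icc (0:ℝ) 1, E₁) := fun q => cst (p + S q.1) + ∑ i, T i q.1 • J (N i q.2)
  have hR : ContDiff ℝ (⊤ : ℕ∞) R := by
    have : ∀ i, ContDiff ℝ (⊤ : ℕ∞) (fun q : E × C(Icc (0:ℝ) 1, E₁) => J (N i q.2)) := fun i =>
      J.contDiff.comp ((hN i).comp contDiff_snd)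
    fun_prop
  let Q : E × C(Icc (0:ℝ) 1, E₁) → E × C(Icc (0:ℝ) 1, E₁) := fun q => (q.1, q.2 - R q)
  have hQ : ContDiff ℝ (⊤ : ℕ∞) Q := by fun_prop
  let γ₀ : C(Icc (0:ℝ) 1, E₁) := cst p
  have hRd : ∀ q : E × C(Icc (0:ℝ) 1, E₁), HasFDerivAt R
      ((cst ∘L S) ∘L (ContinuousLinearMap.fst ℝ E C(Icc (0:ℝ) 1, E₁)) +
        ∑ i, (T i q.1 • (J ∘L (sfApp _ _ _ ((Yd i).comp q.2)) ∘L (ContinuousLinearMap.snd ℝ E C(Icc (0:ℝ) 1, E₁))) +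
         ((T i) ∘L (ContinuousLinearMap.fst ℝ E C(Icc (0:ℝ) 1, E₁))).smulRight (J (N i q.2)))) q := by
    intro q
    have h1 : HasFDerivAt (fun q : E × C(Icc (0:ℝ) 1, E₁) => cst (p + S q.1))
        ((cst ∘L S) ∘L (ContinuousLinearMap.fst ℝ E C(Icc (0:ℝ) 1, E₁))) q := by
      have := (((cst ∘L S) ∘L (ContinuousLinearMap.fst ℝ E C(Icc (0:ℝ) 1, E₁))).hasFDerivAt (x := q)).const_add (cst p)
      refine this.congr_of_eventuallyEq (Eventually.of_forall fun q => ?_)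
      simp
    refine h1.add (HasFDerivAt.fun_sum fun i _ => ?_)
    have h2 : HasFDerivAt (fun q : E × C(Icc (0:ℝ) 1, E₁) => T i q.1) ((T i) ∘L (ContinuousLinearMap.fst ℝ E C(Icc (0:ℝ) 1, E₁))) q :=
      ((T i) ∘L (ContinuousLinearMap.fst ℝ E C(Icc (0:ℝ) 1, E₁))).hasFDerivAt
    have h3 : HasFDerivAt (fun q : E × C(Icc (0:ℝ) 1, E₁) => J (N i q.2))
      (J ∘L (sfApp _ _ _ ((Yd i).comp q.2)) ∘L (ContinuousLinearMap.snd ℝ E C(Icc (0:ℝ) 1, E₁))) q :=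
      J.hasFDerivAt.comp q ((hNd i q.2).comp q hasFDerivAt_snd)
    exact h2.smul h3
  let L : E →L[ℝ] C(Icc (0:ℝ) 1, E₁) := cst ∘L S + ∑ i, (T i).smulRight (J (N i γ₀))
  have hR0 : R (0, γ₀) = γ₀ := by simp [R, γ₀]
  have hQ0 : Q (0, γ₀) = (0, 0) := by simp [Q, hR0]
  let e : (E × C(Icc (0:ℝ) 1, E₁)) ≃L[ℝ] (E × C(Icc (0:ℝ) 1, E₁)) := ContinuousLinearEquiv.skewProd (.refl ℝ E) (.refl ℝ C(Icc (0:ℝ) 1, E₁)) (-L)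
  have hQd : HasFDerivAt Q (e : (E × C(Icc (0:ℝ) 1, E₁)) →L[ℝ] (E × C(Icc (0:ℝ) 1, E₁))) (0, γ₀) := by
    have := (hasFDerivAt_fst (𝕜 := ℝ) (p := ((0, γ₀) : E × C(Icc (0:ℝ) 1, E₁)))).prodMk
      ((hasFDerivAt_snd (𝕜 := ℝ) (p := ((0, γ₀) : E × C(Icc (0:ℝ) 1, E₁)))).sub (hRd (0, γ₀)))
    refine this.congr_fderiv ?_
    refine ContinuousLinearMap.ext fun q => ?_
    refine Prod.ext ?_ ?_
    · simp [e]
    · simp [e, L, sub_eq_add_neg]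
  obtain ⟨g, V, hVo, hV0, hg, hg0, hgV, -⟩ := sf_inverse Q univ isOpen_univ (0, γ₀) (mem_univ _)
    hQ.contDiffOn e hQd
  rw [hQ0] at hV0 hg0
  let ι : E → E × C(Icc (0:ℝ) 1, E₁) := fun y => (y, 0)
  have hι : ContDiff ℝ (⊤ : ℕ∞) ι := by fun_prop
  let c : E → C(Icc (0:ℝ) 1, E₁) := fun y => (g (ι y)).2
  have hVo' : IsOpen (ι ⁻¹' V) := hVo.preimage hι.continuous
  have hcs : ContDiffOn ℝ (⊤ : ℕ∞) c (ι ⁻¹' V) :=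
    contDiff_snd.comp_contDiffOn (hg.comp hι.contDiffOn (fun x hx => hx))
  have hc0 : c 0 = γ₀ := by
    change (g (0, 0)).2 = γ₀
    rw [hg0]
  have hceq : ∀ y ∈ ι ⁻¹' V, c y = R (y, c y) := by
    intro y hy
    have h1 := (hgV _ hy).2
    have h2 : (g (ι y)).1 = y := congrArg Prod.fst h1
    have h3 : (g (ι y)).2 - R (g (ι y)) = 0 := congrArg Prod.snd h1
    have h4 : g (ι y) = (y, c y) := Prod.ext h2 rfl
    rw [h4] at h3
    exact sub_eq_zero.1 h3
  -- derivative identity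
  have hcd : ∀ y ∈ ι ⁻¹' V, ∀ w, fderiv ℝ c y w = cst (S w) + ∑ i, (T i y • J (sfApp _ _ _
      ((Yd i).comp (c y)) (fderiv ℝ c y w)) + T i w • J (N i (c y))) := by
    intro y hy w
    have hd : HasFDerivAt c (fderiv ℝ c y) y :=
      ((hcs.contDiffAt (hVo'.mem_nhds hy)).differentiableAt (by simp)).hasFDerivAt
    have h1 : HasFDerivAt (fun y => R (y, c y)) _ y :=
      (hRd (y, c y)).comp y ((hasFDerivAt_id y).prodMk hd)
    have h2 : c =ᶠ[𝓝 y] fun y => R (y, c y) := by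
      filter_upwards [hVo'.mem_nhds hy] with z hz using hceq z hz
    have h3 := (h1.congr_of_eventuallyEq h2).unique hd
    have h4 := congrArg (fun A : E →L[ℝ] C(Icc (0:ℝ) 1, E₁) => A w) h3
    conv_lhs => rw [← h4]
    simp
  let ev : C(Icc (0:ℝ) 1, E₁) →L[ℝ] E₁ := ContinuousMap.evalCLM ℝ (⟨1, by simp⟩ : Icc (0:ℝ) 1)
  have hΓd : ∀ y ∈ ι ⁻¹' V, ∀ w, fderiv ℝ (fun y => ev (c y)) y w = ev (fderiv ℝ c y w) := by
    intro y hy w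
    have hd : HasFDerivAt c (fderiv ℝ c y) y :=
      ((hcs.contDiffAt (hVo'.mem_nhds hy)).differentiableAt (by simp)).hasFDerivAt
    have : HasFDerivAt (fun y => ev (c y)) (ev ∘L fderiv ℝ c y) y := ev.hasFDerivAt.comp y hd
    rw [this.fderiv]; rfl
  have hev1 : ∀ z, ev (cst z) = z := fun z => rfl
  -- main derivative computation, on a smaller neighbourhood
  have hmain : ∀ᶠ y in 𝓝 (0:E), ∀ i, fderiv ℝ (fun y => ev (c y)) y (v i) = Y i (ev (c y)) := by
    have hcc : ContinuousAt c 0 := hcs.continuousOn.continuousAt (hVo'.mem_nhds hV0)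
    obtain ⟨ε, hε, hcomm'⟩ := Metric.eventually_nhds_iff.1 hcomm
    have hclose : ∀ᶠ y in 𝓝 (0:E), dist (c y) γ₀ < ε := by
      rw [← hc0]
      exact hcc (Metric.ball_mem_nhds _ hε)
    let Lop : E → C(Icc (0:ℝ) 1, E₁) →L[ℝ] C(Icc (0:ℝ) 1, E₁) := fun y => ∑ i, T i y • (J ∘L (sfApp _ _ _ ((Yd i).comp (c y))))
    have hLc : ContinuousAt Lop 0 := by
      have : ∀ i, ContinuousAt (fun y => (Yd i).comp (c y)) 0 := fun i =>
        ContinuousAt.comp (f := c) (ContinuousMap.continuous_postcomp (Yd i)).continuousAt hcc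
      refine tendsto_finsetSum _ fun i _ => ?_
      refine Tendsto.smul ((T i).continuous.continuousAt) ?_
      have h5 : Continuous (fun A : C(Icc (0:ℝ) 1, E₁) →L[ℝ] C(Icc (0:ℝ) 1, E₁) => J ∘L A) := by fun_prop
      exact h5.continuousAt.tendsto.comp
        ((sfApp (Icc (0:ℝ) 1) E₁ E₁).continuous.continuousAt.tendsto.comp (this i))
    have hL0 : Lop 0 = 0 := by
      refine Finset.sum_eq_zero fun i _ => ?_
      rw [map_zero]
      refine ContinuousLinearMap.ext fun h => ?_
      exact zero_smul ℝ (J (sfApp _ _ _ ((Yd i).comp (c 0)) h))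
    have hLsmall : ∀ᶠ y in 𝓝 (0:E), ‖Lop y‖ < 1 := by
      have h6 : ContinuousAt (fun y => ‖Lop y‖) 0 := ContinuousAt.comp (f := Lop)
        (continuous_norm (E := C(Icc (0:ℝ) 1, E₁) →L[ℝ] C(Icc (0:ℝ) 1, E₁))).continuousAt hLc
      refine h6.eventually_lt_const ?_
      beta_reduce
      rw [hL0]
      refine lt_of_eq_of_lt ?_ zero_lt_one
      exact norm_zero (E := C(Icc (0:ℝ) 1, E₁) →L[ℝ] C(Icc (0:ℝ) 1, E₁))
    filter_upwards [hVo'.mem_nhds hV0, hclose, hLsmall] with y hy hyc hyL i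
    rw [hΓd y hy]
    -- candidate
    let η : C(Icc (0:ℝ) 1, E₁) := ⟨fun t => (t : ℝ) • Y i (c y t), by
      have := (hY i).continuous
      fun_prop⟩
    have hη : η = J (N i (c y)) + Lop y η := by
      let W : ℝ → E₁ := fun τ => ∑ k, T k y • Y k (c y (projIcc 0 1 zero_le_one τ))
      have hYc : ∀ k, Continuous (Y k) := fun k => (hY k).continuous
      have hW : Continuous W := by fun_prop
      let G : ℝ → E₁ := fun τ => p + S y + ∫ s in (0:ℝ)..τ, W s
      have hG : ∀ τ, HasDerivAt G (W τ) τ := fun τ =>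
        (hW.integral_hasStrictDerivAt 0 τ).hasDerivAt.const_add _
      have hGc : Continuous G := continuous_iff_continuousAt.2 fun τ => (hG τ).continuousAt
      have hGe : ∀ t : Icc (0:ℝ) 1, G t = c y t := by
        intro t
        conv_rhs => rw [hceq y hy]
        simp only [R, G, W, ContinuousMap.add_apply, ContinuousMap.sum_apply,
          ContinuousMap.smul_apply]
        rw [intervalIntegral.integral_finsetSum]
        · congr 1
          refine Finset.sum_congr rfl fun k _ => ?_
          rw [intervalIntegral.integral_smul]
          rfl
        · intro k _
          apply Continuous.intervalIntegrable
          fun_prop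
      have hD : ∀ τ, HasDerivAt (fun τ : ℝ => τ • Y i (G τ))
          (τ • fderiv ℝ (Y i) (G τ) (W τ) + (1:ℝ) • Y i (G τ)) τ := by
        intro τ
        refine (hasDerivAt_id τ).smul ?_
        exact (((hY i).differentiable (by simp) (G τ)).hasFDerivAt).comp_hasDerivAt τ (hG τ)
      ext t
      have hI := intervalIntegral.integral_eq_sub_of_hasDerivAt (a := 0) (b := (t:ℝ))
        (fun τ _ => hD τ) (by
          apply Continuous.intervalIntegrable
          have := hYc i
          have := hY' i
          fun_prop)
      have h6 : η t = (t:ℝ) • Y i (G t) := by rw [hGe]; rfl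
      rw [h6]
      simp only [zero_smul, sub_zero] at hI
      rw [← hI]
      have h7 : (J (N i (c y)) + Lop y η) t = ∫ τ in (0:ℝ)..t,
          (Y i (c y (projIcc 0 1 zero_le_one τ)) + ∑ k, T k y •
            fderiv ℝ (Y k) (c y (projIcc 0 1 zero_le_one τ)) (η (projIcc 0 1 zero_le_one τ))) := by
        rw [intervalIntegral.integral_add, intervalIntegral.integral_finsetSum]
        · simp only [intervalIntegral.integral_smul, Lop, _root_.sum_apply,
            ContinuousMap.add_apply, ContinuousMap.sum_apply]
          rfl
        · intro k _
          apply Continuous.intervalIntegrable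
          have := hY' k
          fun_prop
        · apply Continuous.intervalIntegrable
          fun_prop
        · apply Continuous.intervalIntegrable
          fun_prop
      rw [h7]
      refine intervalIntegral.integral_congr fun τ hτ => ?_
      rw [uIcc_of_le t.2.1] at hτ
      have hτ' : τ ∈ Icc (0:ℝ) 1 := ⟨hτ.1, hτ.2.trans t.2.2⟩
      have h8 : G τ = c y (projIcc 0 1 zero_le_one τ) := by
        rw [projIcc_of_mem _ hτ']
        exact hGe ⟨τ, hτ'⟩
      have h9 : η (projIcc 0 1 zero_le_one τ) = τ • Y i (c y (projIcc 0 1 zero_le_one τ)) := by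
        rw [projIcc_of_mem _ hτ']; rfl
      beta_reduce
      rw [h8, h9, one_smul, add_comm]
      congr 1
      simp only [W, map_sum, map_smul, Finset.smul_sum]
      refine Finset.sum_congr rfl fun k _ => ?_
      rw [smul_comm]
      congr 2
      refine hcomm' ?_ i k
      exact (ContinuousMap.dist_apply_le_dist (f := c y) (g := γ₀) _).trans_lt hyc
    have hδ : fderiv ℝ c y (v i) = J (N i (c y)) + Lop y (fderiv ℝ c y (v i)) := by
      conv_lhs => rw [hcd y hy]
      simp [hS, hT, Finset.sum_add_distrib, Lop, _root_.sum_apply, add_comm]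
    have hzero : fderiv ℝ c y (v i) - η = 0 := by
      have h10 : fderiv ℝ c y (v i) - η = Lop y (fderiv ℝ c y (v i) - η) := by
        conv_lhs => rw [hδ, hη]
        rw [map_sub]; abel
      by_contra hne
      have h11 : 0 < ‖fderiv ℝ c y (v i) - η‖ := norm_pos_iff.2 hne
      have h12 := (Lop y).le_opNorm (fderiv ℝ c y (v i) - η)
      rw [← h10] at h12
      nlinarith
    rw [sub_eq_zero.1 hzero]
    have h13 : (1:ℝ) • Y i (c y (⟨1, by simp⟩ : Icc (0:ℝ) 1)) = Y i (c y ⟨1, by simp⟩) :=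
      one_smul ℝ _
    exact h13
  obtain ⟨V₂, hV₂, hV₂o, h0V₂⟩ := eventually_nhds_iff.1 hmain
  refine ⟨fun y => ev (c y), ι ⁻¹' V ∩ V₂, hVo'.inter hV₂o, ⟨hV0, h0V₂⟩,
    (ev.contDiff.comp_contDiffOn hcs).mono inter_subset_left, ?_, ?_, ?_⟩
  · simp only [hc0]; rfl
  · intro w
    rw [hΓd 0 hV0, hcd 0 hV0]
    simp only [map_zero, zero_smul, zero_add, map_add, map_sum, map_smul, hev1, hc0]
    congr 1
    refine Finset.sum_congr rfl fun k _ => ?_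
    congr 1
    change (∫ τ in (0:ℝ)..1, Y k p) = Y k p
    simp
  · intro y hy i
    exact hV₂ y hy.2 i

lemma sf_dual {V : Type} [NormedAddCommGroup V] [NormedSpace ℝ V] [FiniteDimensional ℝ V] {m : ℕ}
    (v : Fin m → V) (hv : LinearIndependent ℝ v) :
    ∃ T : Fin m → V →L[ℝ] ℝ, ∀ i j, T i (v j) = if i = j then 1 else 0 := by
  have hk : (Fintype.linearCombination ℝ v).ker = ⊥ :=
    LinearMap.ker_eq_bot.2 (hv.fintypeLinearCombination_injective)
  obtain ⟨g, hg⟩ := LinearMap.exists_leftInverse_of_injective _ hk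
  refine ⟨fun i => LinearMap.toContinuousLinearMap ((LinearMap.proj i) ∘ₗ g), fun i j => ?_⟩
  have h1 : g (v j) = Pi.single j 1 := by
    have := LinearMap.congr_fun hg (Pi.single j 1)
    simpa using this
  simp [h1, Pi.single_apply]

/-- Local solvability of `Zᵢ u = Gᵢ` for commuting independent fields. -/
lemma sf_solve {E : Type} [NormedAddCommGroup E] [NormedSpace ℝ E] [FiniteDimensional ℝ E] {m : ℕ}
    (Z : Fin m → E → E) (G : Fin m → E → ℝ) (O : Set E) (hO : IsOpen O) (x₀ : E) (hx₀ : x₀ ∈ O)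
    (hZ : ∀ i, ContDiffOn ℝ (⊤ : ℕ∞) (Z i) O) (hG : ∀ i, ContDiffOn ℝ (⊤ : ℕ∞) (G i) O)
    (hind : LinearIndependent ℝ (fun i => Z i x₀))
    (hcomm : ∀ x ∈ O, ∀ i j, fderiv ℝ (Z i) x (Z j x) = fderiv ℝ (Z j) x (Z i x))
    (hcomp : ∀ x ∈ O, ∀ i j, fderiv ℝ (G i) x (Z j x) = fderiv ℝ (G j) x (Z i x)) :
    ∃ (u : E → ℝ) (V : Set E), IsOpen V ∧ x₀ ∈ V ∧ ContDiffOn ℝ (⊤ : ℕ∞) u V ∧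
      ∀ x ∈ V, ∀ i, fderiv ℝ u x (Z i x) = G i x := by
  have : CompleteSpace E := FiniteDimensional.complete ℝ E
  choose Z' hZ' hZe using fun i => sf_extend (Z i) O hO x₀ hx₀ (hZ i)
  choose G' hG' hGe using fun i => sf_extend (G i) O hO x₀ hx₀ (hG i)
  have hZe0 : ∀ i, Z' i x₀ = Z i x₀ := fun i => (hZe i).self_of_nhds
  let Y : Fin m → E × ℝ → E × ℝ := fun i q => (Z' i q.1, G' i q.1)
  have hY : ∀ i, ContDiff ℝ (⊤ : ℕ∞) (Y i) := fun i =>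
    ((hZ' i).comp contDiff_fst).prodMk ((hG' i).comp contDiff_fst)
  have hYd : ∀ i (q w : E × ℝ), fderiv ℝ (Y i) q w =
      (fderiv ℝ (Z' i) q.1 w.1, fderiv ℝ (G' i) q.1 w.1) := by
    intro i q w
    have h1 : HasFDerivAt (fun q : E × ℝ => Z' i q.1) _ q :=
      (((hZ' i).differentiable (by simp) q.1).hasFDerivAt).comp q hasFDerivAt_fst
    have h2 : HasFDerivAt (fun q : E × ℝ => G' i q.1) _ q :=
      (((hG' i).differentiable (by simp) q.1).hasFDerivAt).comp q hasFDerivAt_fst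
    rw [(h1.prodMk h2).fderiv]
    simp
  have hall : ∀ᶠ x in 𝓝 x₀, x ∈ O ∧ ∀ i, (Z' i =ᶠ[𝓝 x] Z i) ∧ (G' i =ᶠ[𝓝 x] G i) :=
    (show ∀ᶠ x in 𝓝 x₀, x ∈ O from hO.mem_nhds hx₀).and
      (eventually_all.2 fun i => (hZe i).eventually_nhds.and (hGe i).eventually_nhds)
  obtain ⟨T, hT⟩ := sf_dual _ hind
  let S : E →L[ℝ] E × ℝ := ContinuousLinearMap.inl ℝ E ℝ ∘L
    (ContinuousLinearMap.id ℝ E - ∑ i, (T i).smulRight (Z i x₀))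
  obtain ⟨Γ, V, hVo, hV0, hΓ, hΓ0, hΓd0, hΓd⟩ := sf_flow Y hY (x₀, (0:ℝ)) (by
      have : ∀ᶠ q : E × ℝ in 𝓝 (x₀, (0:ℝ)), q.1 ∈ O ∧
          ∀ i, (Z' i =ᶠ[𝓝 q.1] Z i) ∧ (G' i =ᶠ[𝓝 q.1] G i) :=
        (continuousAt_fst (p := (x₀, (0:ℝ)))).eventually hall
      filter_upwards [this] with q hq i j
      obtain ⟨h1, h2⟩ := hq
      rw [hYd, hYd]
      simp only [Y]
      rw [(h2 i).1.fderiv_eq, (h2 j).1.fderiv_eq, (h2 i).2.fderiv_eq, (h2 j).2.fderiv_eq,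
        (h2 i).1.self_of_nhds, (h2 j).1.self_of_nhds, hcomm _ h1, hcomp _ h1])
    S T (fun i => Z i x₀) hT (by
      intro i
      simp [S, hT])
  have hdiff : ∀ y ∈ V, HasFDerivAt Γ (fderiv ℝ Γ y) y := fun y hy =>
    ((hΓ.contDiffAt (hVo.mem_nhds hy)).differentiableAt (by simp)).hasFDerivAt
  have h0d : HasFDerivAt (fun y => (Γ y).1) ((ContinuousLinearEquiv.refl ℝ E : E ≃L[ℝ] E) : E →L[ℝ] E) 0 := by
    have h1 : HasFDerivAt (fun y => (Γ y).1) ((ContinuousLinearMap.fst ℝ E ℝ) ∘L fderiv ℝ Γ 0) 0 :=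
      (ContinuousLinearMap.fst ℝ E ℝ).hasFDerivAt.comp 0 (hdiff 0 hV0)
    refine h1.congr_fderiv (ContinuousLinearMap.ext fun w => ?_)
    simp [hΓd0, S, Y, hZe0, Prod.fst_sum]
  obtain ⟨g, V', hV'o, hV'0, hg, hg0, hgV, -⟩ := sf_inverse (fun y => (Γ y).1) V hVo 0 hV0
    (contDiff_fst.comp_contDiffOn hΓ) _ h0d
  simp only [hΓ0] at hV'0 hg0
  obtain ⟨V₂, hV₂, hV₂o, h0V₂⟩ := eventually_nhds_iff.1 hall
  refine ⟨fun x => (Γ (g x)).2, V' ∩ V₂, hV'o.inter hV₂o, ⟨hV'0, h0V₂⟩, ?_, ?_⟩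
  · exact contDiff_snd.comp_contDiffOn ((hΓ.comp hg (fun x hx => (hgV x hx).1)).mono inter_subset_left)
  · rintro x ⟨hx, hx2⟩ i
    obtain ⟨hy, hyx⟩ := hgV x hx
    have hgd : HasFDerivAt g (fderiv ℝ g x) x :=
      ((hg.contDiffAt (hV'o.mem_nhds hx)).differentiableAt (by simp)).hasFDerivAt
    -- Dg (Z_i x) = v_i
    have hid : HasFDerivAt (fun z => (Γ (g z)).1)
        ((ContinuousLinearMap.fst ℝ E ℝ) ∘L (fderiv ℝ Γ (g x)) ∘L fderiv ℝ g x) x :=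
      (ContinuousLinearMap.fst ℝ E ℝ).hasFDerivAt.comp x ((hdiff _ hy).comp x hgd)
    have hid2 : HasFDerivAt (fun z => (Γ (g z)).1) (ContinuousLinearMap.id ℝ E) x := by
      refine (hasFDerivAt_id x).congr_of_eventuallyEq ?_
      filter_upwards [hV'o.mem_nhds hx] with z hz using (hgV z hz).2
    have hAB := hid.unique hid2
    let A : E →ₗ[ℝ] E := ((ContinuousLinearMap.fst ℝ E ℝ) ∘L (fderiv ℝ Γ (g x)) : E →L[ℝ] E)
    let B : E →ₗ[ℝ] E := (fderiv ℝ g x : E →L[ℝ] E)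
    have hAB' : A * B = 1 := by
      refine LinearMap.ext fun w => ?_
      exact congrArg (fun C : E →L[ℝ] E => C w) hAB
    have hBA : B * A = 1 := mul_eq_one_comm.1 hAB'
    have hYx : fderiv ℝ Γ (g x) (Z i x₀) = (Z i x, G i x) := by
      rw [hΓd _ hy i]
      simp only [Y]
      rw [hyx, ((hV₂ x hx2).2 i).1.self_of_nhds, ((hV₂ x hx2).2 i).2.self_of_nhds]
    have hBZ : fderiv ℝ g x (Z i x) = Z i x₀ := by
      have h1 : A (Z i x₀) = Z i x := congrArg Prod.fst hYx
      have h2 : B (A (Z i x₀)) = Z i x₀ := LinearMap.congr_fun hBA (Z i x₀)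
      rw [h1] at h2
      exact h2
    have hu : HasFDerivAt (fun z => (Γ (g z)).2)
        ((ContinuousLinearMap.snd ℝ E ℝ) ∘L (fderiv ℝ Γ (g x)) ∘L fderiv ℝ g x) x :=
      (ContinuousLinearMap.snd ℝ E ℝ).hasFDerivAt.comp x ((hdiff _ hy).comp x hgd)
    rw [hu.fderiv]
    simp [hBZ, hYx]

lemma sf_jacobi (q r : ℕ)
    (X : Fin r → (Fin q → ℝ) → (Fin q → ℝ))
    (hX : ∀ i, ContDiff ℝ (⊤ : ℕ∞) (X i))
    (hindep : ∀ x : Fin q → ℝ, LinearIndependent ℝ (fun i : Fin r => X i x))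
    (h : Fin r → Fin r → Fin r → (Fin q → ℝ) → ℝ)
    (hh : ∀ i j k, ContDiff ℝ (⊤ : ℕ∞) (h i j k))
    (hbra : ∀ (i j : Fin r) (x : Fin q → ℝ),
      VectorField.lieBracket ℝ (X i) (X j) x
        = h i j i x • X i x + h i j j x • X j x) (i j k : Fin r) (hij : i ≠ j) (hik : i ≠ k)
    (x : Fin q → ℝ) :
    fderiv ℝ (h i k i) x (X j x) - fderiv ℝ (h i j i) x (X k x) =
      h j k j x * h i j i x + h j k k x * h i k i x := by
  obtain ⟨T, hT⟩ := sf_dual _ (hindep x)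
  have hXd : ∀ i, DifferentiableAt ℝ (X i) x := fun i => (hX i).differentiable (by simp) x
  have hhd : ∀ i j k, DifferentiableAt ℝ (h i j k) x := fun i j k =>
    (hh i j k).differentiable (by simp) x
  have hb : ∀ i j, VectorField.lieBracket ℝ (X i) (X j) =
      (fun y => h i j i y • X i y) + (fun y => h i j j y • X j y) := fun i j => funext (hbra i j)
  have L := VectorField.leibniz_identity_lieBracket (𝕜 := ℝ) (n := (⊤ : ℕ∞)) (x := x)
    (by rw [minSmoothness_of_isRCLikeNormedField]; exact WithTop.coe_le_coe.2 (le_top : (2:ℕ∞) ≤ ⊤)) (hX i).contDiffAt (hX j).contDiffAt (hX k).contDiffAt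
  rw [hb j k, hb i j, hb i k] at L
  rw [VectorField.lieBracket_add_right, VectorField.lieBracket_add_right,
    VectorField.lieBracket_add_left,
    VectorField.lieBracket_smul_right (hhd _ _ _) (hXd _),
    VectorField.lieBracket_smul_right (hhd _ _ _) (hXd _),
    VectorField.lieBracket_smul_right (hhd _ _ _) (hXd _),
    VectorField.lieBracket_smul_right (hhd _ _ _) (hXd _),
    VectorField.lieBracket_smul_left (hhd _ _ _) (hXd _),
    VectorField.lieBracket_smul_left (hhd _ _ _) (hXd _),
    VectorField.lieBracket_swap (V := X j) (W := X i)] at L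
  · simp only [hbra] at L
    have L2 := congrArg (T i) L
    simp only [map_add, map_smul, map_neg, hT, hij, hik, if_true, if_false, smul_eq_mul] at L2
    linarith
  all_goals exact (hhd _ _ _).smul (hXd _)

lemma sf_bracket (q : ℕ) (V W : (Fin q → ℝ) → (Fin q → ℝ)) (f g : (Fin q → ℝ) → ℝ)
    (x : Fin q → ℝ) (hV : DifferentiableAt ℝ V x) (hW : DifferentiableAt ℝ W x)
    (hf : DifferentiableAt ℝ f x) (hg : DifferentiableAt ℝ g x) (a b : ℝ)
    (hVW : VectorField.lieBracket ℝ V W x = a • V x + b • W x) :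
    VectorField.lieBracket ℝ (fun y => f y • V y) (fun y => g y • W y) x =
      (f x * g x * a - g x * fderiv ℝ f x (W x)) • V x +
      (f x * g x * b + f x * fderiv ℝ g x (V x)) • W x := by
  rw [VectorField.lieBracket_smul_right hg hW, VectorField.lieBracket_smul_left hf hV, hVW]
  simp only [map_smul, smul_eq_mul]
  module

/-- Modified Frobenius Theorem by rescaling: pointwise linearly
independent vector fields `X₁,…,X_r` with `[Xᵢ,Xⱼ] = hᵢⱼⁱ Xᵢ + hᵢⱼʲ Xⱼ` can
locally be individually rescaled by nowhere-vanishing functions so that the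
rescaled fields pairwise commute. -/
theorem stmt_8 (q r : ℕ)
    (X : Fin r → (Fin q → ℝ) → (Fin q → ℝ))
    (hX : ∀ i, ContDiff ℝ (⊤ : ℕ∞) (X i))
    (hindep : ∀ x : Fin q → ℝ, LinearIndependent ℝ (fun i : Fin r => X i x))
    (h : Fin r → Fin r → Fin r → (Fin q → ℝ) → ℝ)
    (hh : ∀ i j k, ContDiff ℝ (⊤ : ℕ∞) (h i j k))
    (hbra : ∀ (i j : Fin r) (x : Fin q → ℝ),
      VectorField.lieBracket ℝ (X i) (X j) x
        = h i j i x • X i x + h i j j x • X j x) :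
    ∀ x₀ : Fin q → ℝ, ∃ U : Set (Fin q → ℝ), IsOpen U ∧ x₀ ∈ U ∧
      ∃ f : Fin r → (Fin q → ℝ) → ℝ,
        (∀ i, ContDiffOn ℝ (⊤ : ℕ∞) (f i) U) ∧
        (∀ i, ∀ x ∈ U, f i x ≠ 0) ∧
        ∀ (i j : Fin r), ∀ x ∈ U,
          VectorField.lieBracket ℝ
            (fun y => f i y • X i y) (fun y => f j y • X j y) x = 0 := by
  induction r with
  | zero =>
    intro x₀
    exact ⟨univ, isOpen_univ, mem_univ _, fun i => i.elim0, fun i => i.elim0, fun i => i.elim0,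
      fun i => i.elim0⟩
  | succ r ih =>
    intro x₀
    have hXd : ∀ i x, DifferentiableAt ℝ (X i) x := fun i x => (hX i).differentiable (by simp) x
    have hhd : ∀ i j k x, DifferentiableAt ℝ (h i j k) x := fun i j k x =>
      (hh i j k).differentiable (by simp) x
    have step : ∀ i : Fin (r + 1), ∃ (u : (Fin q → ℝ) → ℝ) (V : Set (Fin q → ℝ)), IsOpen V ∧
        x₀ ∈ V ∧ ContDiffOn ℝ (⊤ : ℕ∞) u V ∧
        ∀ x ∈ V, ∀ j : Fin r, fderiv ℝ u x (X (i.succAbove j) x) =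
          h i (i.succAbove j) i x := by
      intro i
      let s := i.succAbove
      have hs : Function.Injective s := Fin.succAbove_right_injective
      obtain ⟨O, hO, hx₀, f, hf, hf0, hfc⟩ := ih (fun j => X (s j)) (fun j => hX _)
        (fun x => (hindep x).comp s hs) (fun a b c => h (s a) (s b) (s c)) (fun a b c => hh _ _ _)
        (fun a b x => hbra _ _ x) x₀
      have hfd : ∀ j, ∀ x ∈ O, DifferentiableAt ℝ (f j) x := fun j x hx =>
        ((hf j).contDiffAt (hO.mem_nhds hx)).differentiableAt (by simp)
      obtain ⟨u, V, hVo, hV0, hu, huV⟩ := sf_solve (fun j y => f j y • X (s j) y)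
        (fun j y => f j y * h i (s j) i y) O hO x₀ hx₀
        (fun j => (hf j).smul (hX _).contDiffOn) (fun j => (hf j).mul (hh _ _ _).contDiffOn)
        (by
          have h1 := ((hindep x₀).comp s hs).units_smul
            (fun j => Units.mk0 (f j x₀) (hf0 j x₀ hx₀))
          exact h1)
        (by
          intro x hx a b
          have h1 := hfc b a x hx
          rw [VectorField.lieBracket_eq] at h1
          exact sub_eq_zero.1 h1)
        (by
          intro x hx a b
          by_cases hab : a = b
          · rw [hab]
          have hJ := sf_jacobi q (r + 1) X hX hindep h hh hbra i (s a) (s b)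
            (Fin.succAbove_ne i a).symm (Fin.succAbove_ne i b).symm x
          have hB := hfc a b x hx
          rw [sf_bracket q (X (s a)) (X (s b)) (f a) (f b) x (hXd _ _) (hXd _ _) (hfd a x hx)
            (hfd b x hx) _ _ (hbra _ _ x)] at hB
          obtain ⟨T, hT⟩ := sf_dual _ (hindep x)
          have hsab : s a ≠ s b := fun e => hab (hs e)
          have hB1 := congrArg (T (s a)) hB
          have hB2 := congrArg (T (s b)) hB
          simp only [map_add, map_smul, hT, hsab, hsab.symm, if_true, if_false, smul_eq_mul,
            map_zero, mul_one, mul_zero, add_zero, zero_add] at hB1 hB2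
          have hd : ∀ j, fderiv ℝ (fun y => f j y * h i (s j) i y) x =
              f j x • fderiv ℝ (h i (s j) i) x + h i (s j) i x • fderiv ℝ (f j) x := fun j =>
            fderiv_fun_mul (hfd j x hx) (hhd _ _ _ x)
          rw [hd, hd]
          simp only [add_apply, smul_apply, map_smul, smul_eq_mul]
          linear_combination (-f a x * f b x) * hJ - h i (s a) i x * hB1 - h i (s b) i x * hB2)
      refine ⟨u, V ∩ O, hVo.inter hO, ⟨hV0, hx₀⟩, hu.mono inter_subset_left, ?_⟩
      rintro x ⟨hx, hxO⟩ j
      have h1 := huV x hx j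
      rw [map_smul, smul_eq_mul] at h1
      exact mul_left_cancel₀ (hf0 j x hxO) h1
    choose u V hVo hV0 hu huV using step
    have hU : IsOpen (⋂ i, V i) := isOpen_iInter_of_finite hVo
    refine ⟨⋂ i, V i, hU, mem_iInter.2 hV0, fun i y => Real.exp (u i y), ?_, ?_, ?_⟩
    · exact fun i => ((hu i).mono (iInter_subset _ i)).exp
    · exact fun i x _ => (Real.exp_pos _).ne'
    · intro i j x hx
      by_cases hij : i = j
      · subst hij
        simp
      have hxV : ∀ i, x ∈ V i := mem_iInter.1 hx
      have hud : ∀ i, DifferentiableAt ℝ (u i) x := fun i =>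
        ((hu i).contDiffAt ((hVo i).mem_nhds (hxV i))).differentiableAt (by simp)
      have hval : ∀ i j, i ≠ j → fderiv ℝ (fun y => Real.exp (u i y)) x (X j x) =
          Real.exp (u i x) * h i j i x := by
        intro i j hij
        obtain ⟨k, rfl⟩ := Fin.exists_succAbove_eq hij.symm
        rw [fderiv_exp (hud i)]
        simp [huV i x (hxV i) k]
      have hanti : h j i j x = - h i j j x := by
        obtain ⟨T, hT⟩ := sf_dual _ (hindep x)
        have h1 := VectorField.lieBracket_swap (𝕜 := ℝ) (V := X j) (W := X i) (x := x)
        rw [hbra, hbra] at h1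
        have h2 := congrArg (T j) h1
        have hji : j ≠ i := fun e => hij e.symm
        simpa [hT, hij, hji] using h2
      rw [sf_bracket q (X i) (X j) _ _ x (hXd _ _) (hXd _ _) (hud i).exp (hud j).exp _ _
        (hbra i j x), hval i j hij, hval j i (fun e => hij e.symm), hanti]
      module
end
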